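/- Let (L,(·,·),Φ) be a p.n. root lattice with Weyl group W and let w ∈ W. Then k_5(L,w) = k_4(L,w). -/

import Mathlib

open Submodule

/-- A (possibly nonreduced) root lattice, modeled inside the ℚ-vector space `V = L ⊗ ℚ`
(the lattice itself is `L = span ℤ Φ`, a free ℤ-module of rank `dim V ≥ 1`). -/
structure IsPNRootLattice {V : Type} [AddCommGroup V] [Module ℚ V]
    (B : V →ₗ[ℚ] V →ₗ[ℚ] ℚ) (Φ : Set V) : Prop where
  finite : Φ.Finite
  nonempty : Φ.Nonempty
  ne_zero : ∀ α ∈ Φ, α ≠ 0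
  symm : ∀ x y : V, B x y = B y x
  posdef : ∀ x : V, x ≠ 0 → 0 < B x x
  pair_int : ∀ α ∈ Φ, ∀ β ∈ Φ, ∃ c : ℤ, 2 * B β α = (c : ℚ) * B α α
  refl_maps : ∀ α ∈ Φ, (fun x => x - (2 * B x α / B α α) • α) '' Φ = Φ
  span_rat : span ℚ Φ = ⊤

/-- The reflection `s_α : x ↦ x - (2 (x,α) / (α,α)) • α`, as a ℚ-linear endomorphism. -/
noncomputable def reflV {V : Type} [AddCommGroup V] [Module ℚ V]
    (B : V →ₗ[ℚ] V →ₗ[ℚ] ℚ) (α : V) : Module.End ℚ V :=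
  LinearMap.id - ((2 / B α α) • (B.flip α)).smulRight α

/-- `(α_1, …, α_k)` is a presentation of `w`: all `α_i` are roots and
`w = s_{α_1} ∘ ⋯ ∘ s_{α_k}`. -/
def IsPres {V : Type} [AddCommGroup V] [Module ℚ V]
    (B : V →ₗ[ℚ] V →ₗ[ℚ] ℚ) (Φ : Set V) (w : Module.End ℚ V) (l : List V) : Prop :=
  (∀ α ∈ l, α ∈ Φ) ∧ (l.map (reflV B)).prod = w

/-- The length `l(w)`: the minimal length of a presentation of `w`. -/
noncomputable def len {V : Type} [AddCommGroup V] [Module ℚ V]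
    (B : V →ₗ[ℚ] V →ₗ[ℚ] ℚ) (Φ : Set V) (w : Module.End ℚ V) : ℕ :=
  sInf {k | ∃ l : List V, IsPres B Φ w l ∧ l.length = k}

/-- `k₂(L, L₁)`: the minimal `k` such that there are roots `α_1, …, α_k` with
`L = L₁ + Σ ℤ α_i`, where `L = span ℤ Φ`. -/
noncomputable def k2 {V : Type} [AddCommGroup V] [Module ℚ V]
    (Φ : Set V) (L1 : Submodule ℤ V) : ℕ :=
  sInf {k | ∃ f : Fin k → V, (∀ i, f i ∈ Φ) ∧ L1 ⊔ span ℤ (Set.range f) = span ℤ Φ}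

/-- `k₄(L, w)`: the minimum of `k₂(L, L₁)` over the subroot lattices `L₁` of all
reduced presentations of `w`. -/
noncomputable def k4 {V : Type} [AddCommGroup V] [Module ℚ V]
    (B : V →ₗ[ℚ] V →ₗ[ℚ] ℚ) (Φ : Set V) (w : Module.End ℚ V) : ℕ :=
  sInf {m | ∃ l : List V, IsPres B Φ w l ∧ l.length = len B Φ w ∧
    k2 Φ (span ℤ {α | α ∈ l}) = m}

/-- `k₅(L, w)`: the minimal `k` such that `w` has a presentation of length `l(w) + 2k`
whose subroot lattice is the full lattice `L = span ℤ Φ`. -/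
noncomputable def k5 {V : Type} [AddCommGroup V] [Module ℚ V]
    (B : V →ₗ[ℚ] V →ₗ[ℚ] ℚ) (Φ : Set V) (w : Module.End ℚ V) : ℕ :=
  sInf {k | ∃ l : List V, IsPres B Φ w l ∧ l.length = len B Φ w + 2 * k ∧
    span ℤ {α | α ∈ l} = span ℤ Φ}

section Aux

variable {V : Type} [AddCommGroup V] [Module ℚ V]
variable {B : V →ₗ[ℚ] V →ₗ[ℚ] ℚ} {Φ : Set V}

theorem reflV_apply (a x : V) : reflV B a x = x - (2 * B x a / B a a) • a := by
  simp [reflV, div_mul_eq_mul_div]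

theorem IsPNRootLattice.pos (h : IsPNRootLattice B Φ) {a : V} (ha : a ∈ Φ) : 0 < B a a :=
  h.posdef a (h.ne_zero a ha)

theorem IsPNRootLattice.refl_mem (h : IsPNRootLattice B Φ) {a b : V} (ha : a ∈ Φ) (hb : b ∈ Φ) :
    reflV B a b ∈ Φ := by
  rw [← h.refl_maps a ha]
  exact ⟨b, hb, (reflV_apply a b).symm⟩

theorem IsPNRootLattice.iso (h : IsPNRootLattice B Φ) {a : V} (ha : a ∈ Φ) (x y : V) :
    B (reflV B a x) (reflV B a y) = B x y := by
  have hp := (h.pos ha).ne'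
  simp only [reflV_apply, map_sub, map_smul, LinearMap.sub_apply, LinearMap.smul_apply, smul_eq_mul]
  rw [h.symm a y]
  field_simp
  ring

theorem IsPNRootLattice.invol (h : IsPNRootLattice B Φ) {a : V} (ha : a ∈ Φ) (x : V) :
    reflV B a (reflV B a x) = x := by
  have hp := (h.pos ha).ne'
  have e : 2 * B (reflV B a x) a / B a a = - (2 * B x a / B a a) := by
    simp only [reflV_apply, map_sub, map_smul, LinearMap.sub_apply, LinearMap.smul_apply,
      smul_eq_mul]
    field_simp
    ring
  rw [reflV_apply a (reflV B a x), e, reflV_apply]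
  module

theorem IsPNRootLattice.conj (h : IsPNRootLattice B Φ) {a b : V} (ha : a ∈ Φ) (x : V) :
    reflV B (reflV B a b) (reflV B a x) = reflV B a (reflV B b x) := by
  rw [reflV_apply (reflV B a b), h.iso ha, h.iso ha, reflV_apply b x, map_sub, map_smul]

theorem IsPNRootLattice.swap1 (h : IsPNRootLattice B Φ) {a b : V} (ha : a ∈ Φ) :
    reflV B (reflV B a b) * reflV B a = reflV B a * reflV B b := by
  ext x
  exact h.conj ha x

theorem IsPNRootLattice.swap2 (h : IsPNRootLattice B Φ) {a b : V} (hb : b ∈ Φ) :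
    reflV B b * reflV B (reflV B b a) = reflV B a * reflV B b := by
  ext x
  have := h.conj (b := a) hb (reflV B b x)
  rw [h.invol hb] at this
  simp only [Module.End.mul_apply]
  rw [this, h.invol hb]

/-- ℤ-span of a list -/
def zsp (l : List V) : Submodule ℤ V := span ℤ {α | α ∈ l}

theorem zsp_cons (a : V) (l : List V) : zsp (a :: l) = span ℤ {a} ⊔ zsp l := by
  unfold zsp
  rw [← span_union]
  congr 1
  ext x
  simp

/-- ℚ-span of a list -/
def qsp (l : List V) : Submodule ℚ V := span ℚ {α | α ∈ l}

theorem qsp_cons (a : V) (l : List V) : qsp (a :: l) = span ℚ {a} ⊔ qsp l := by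
  unfold qsp
  rw [← span_union]
  congr 1
  ext x
  simp

theorem IsPNRootLattice.zrefl (h : IsPNRootLattice B Φ) {a b : V} (ha : a ∈ Φ) (hb : b ∈ Φ) :
    ∃ c : ℤ, reflV B a b = b - c • a := by
  obtain ⟨c, hc⟩ := h.pair_int a ha b hb
  refine ⟨c, ?_⟩
  rw [reflV_apply, hc, mul_div_assoc, div_self (h.pos ha).ne', mul_one, Int.cast_smul_eq_zsmul]

theorem IsPNRootLattice.zsp_swap (h : IsPNRootLattice B Φ) {a b : V} (ha : a ∈ Φ) (hb : b ∈ Φ) :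
    span ℤ {a} ⊔ span ℤ {reflV B a b} = span ℤ {a} ⊔ span ℤ {b} := by
  obtain ⟨c, hc⟩ := h.zrefl ha hb
  rw [hc]
  apply le_antisymm
  · refine sup_le le_sup_left ?_
    rw [span_singleton_le_iff_mem]
    exact sub_mem (mem_sup_right (mem_span_singleton_self b))
      (smul_mem _ c (mem_sup_left (mem_span_singleton_self a)))
  · refine sup_le le_sup_left ?_
    rw [span_singleton_le_iff_mem]
    have := add_mem (mem_sup_right (mem_span_singleton_self (b - c • a)))
      (smul_mem _ c (mem_sup_left (T := span ℤ {b - c • a}) (mem_span_singleton_self (R := ℤ) a)))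
    simpa using this

/-- product of a list of reflections -/
noncomputable def prd (B : V →ₗ[ℚ] V →ₗ[ℚ] ℚ) (l : List V) : Module.End ℚ V :=
  (l.map (reflV B)).prod

theorem prd_cons (a : V) (l : List V) : prd B (a :: l) = reflV B a * prd B l := by
  simp [prd]

theorem prd_nil : prd B ([] : List V) = 1 := by
  simp [prd]

/-- equivalence of presentations -/
def Eqv (B : V →ₗ[ℚ] V →ₗ[ℚ] ℚ) (Φ : Set V) (l l' : List V) : Prop :=
  (∀ x ∈ l', x ∈ Φ) ∧ l'.length = l.length ∧ prd B l' = prd B l ∧ zsp l' = zsp l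

/-- reducible presentations -/
def Rdc (B : V →ₗ[ℚ] V →ₗ[ℚ] ℚ) (Φ : Set V) (l : List V) : Prop :=
  ∃ (l' : List V) (g : V), g ∈ Φ ∧ (∀ x ∈ l', x ∈ Φ) ∧ l'.length + 2 = l.length ∧
    prd B l' = prd B l ∧ zsp l' ⊔ span ℤ {g} = zsp l

theorem Rdc.cons {a : V} {l : List V} (ha : a ∈ Φ) (hr : Rdc B Φ l) : Rdc B Φ (a :: l) := by
  obtain ⟨l', g, hg, h1, h2, h3, h4⟩ := hr
  refine ⟨a :: l', g, hg, ?_, ?_, ?_, ?_⟩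
  · simpa using ⟨ha, h1⟩
  · simp; omega
  · rw [prd_cons, prd_cons, h3]
  · rw [zsp_cons, zsp_cons, sup_assoc, h4]

theorem Eqv.cons {a : V} {l l' : List V} (ha : a ∈ Φ) (hr : Eqv B Φ l l') :
    Eqv B Φ (a :: l) (a :: l') := by
  obtain ⟨h1, h2, h3, h4⟩ := hr
  refine ⟨?_, ?_, ?_, ?_⟩
  · simpa using ⟨ha, h1⟩
  · simp [h2]
  · rw [prd_cons, prd_cons, h3]
  · rw [zsp_cons, zsp_cons, h4]

theorem Rdc.of_eqv {l l' : List V} (he : Eqv B Φ l l') (hr : Rdc B Φ l') : Rdc B Φ l := by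
  obtain ⟨l₁, g, hg, h1, h2, h3, h4⟩ := hr
  obtain ⟨e1, e2, e3, e4⟩ := he
  exact ⟨l₁, g, hg, h1, h2.trans e2, h3.trans e3, h4.trans e4⟩

/-- parallel roots -/
theorem IsPNRootLattice.par (h : IsPNRootLattice B Φ) {a b : V} (ha : a ∈ Φ) (hb : b ∈ Φ)
    (hab : B a a * B b b ≤ B a b ^ 2) :
    reflV B a = reflV B b ∧ ∃ g ∈ Φ, span ℤ {a} ⊔ span ℤ {b} = span ℤ {g} := by
  have hA := h.pos ha
  have hB := h.pos hb
  have hs := h.symm a b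
  have hbc : b = (B a b / B a a) • a := by
    by_contra hne
    have := h.posdef _ (sub_ne_zero.2 hne)
    simp only [map_sub, map_smul, LinearMap.sub_apply, LinearMap.smul_apply, smul_eq_mul,
      ← hs] at this
    have e : B b b - B a b / B a a * B a b - B a b / B a a * (B a b - B a b / B a a * B a a)
      = (B a a * B b b - B a b ^ 2) / B a a := by field_simp; ring
    rw [e, div_pos_iff_of_pos_right hA] at this
    linarith
  obtain ⟨p, hp⟩ := h.pair_int a ha b hb
  obtain ⟨q, hq⟩ := h.pair_int b hb a ha
  set c := B a b / B a a with hc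
  have hc0 : c ≠ 0 := by
    intro h0
    rw [h0, zero_smul] at hbc
    exact h.ne_zero b hb hbc
  have hpc : (p : ℚ) = 2 * c := by
    rw [hc, hs]; field_simp; linarith
  have hqc : (q : ℚ) * c = 2 := by
    rw [hbc] at hq
    simp only [map_smul, LinearMap.smul_apply, smul_eq_mul] at hq
    have : (2 - q * c) * (c * B a a) = 0 := by linarith
    have h2 : c * B a a ≠ 0 := mul_ne_zero hc0 hA.ne'
    have := (mul_eq_zero.1 this).resolve_right h2
    linarith
  constructor
  · ext x
    rw [hbc, reflV_apply, reflV_apply]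
    simp only [map_smul, LinearMap.smul_apply, smul_eq_mul, smul_smul]
    congr 2
    field_simp
  · have hpq : p * q = 4 := by
      have : (p : ℚ) * q = 4 := by rw [hpc]; linarith
      exact_mod_cast this
    have key : (∃ k : ℤ, b = k • a) ∨ (∃ k : ℤ, a = k • b) := by
      rcases Int.even_or_odd' p with ⟨k, hk | hk⟩
      · left
        refine ⟨k, ?_⟩
        have : c = k := by
          rw [hk] at hpc; push_cast at hpc; linarith
        rw [hbc, this, Int.cast_smul_eq_zsmul]
      · right
        have hq2 : ∃ j, q = 2 * j := by
          rcases Int.even_or_odd' q with ⟨j, hj | hj⟩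
          · exact ⟨j, hj⟩
          · exfalso
            rw [hk, hj] at hpq
            ring_nf at hpq
            omega
        obtain ⟨j, hj⟩ := hq2
        refine ⟨j, ?_⟩
        have : (j : ℚ) * c = 1 := by
          rw [hj] at hqc; push_cast at hqc; linarith
        rw [hbc, ← Int.cast_smul_eq_zsmul ℚ, smul_smul, this, one_smul]
    rcases key with ⟨k, hk⟩ | ⟨k, hk⟩
    · refine ⟨a, ha, sup_eq_left.2 ?_⟩
      rw [span_singleton_le_iff_mem, hk]
      exact smul_mem _ _ (mem_span_singleton_self a)
    · refine ⟨b, hb, sup_eq_right.2 ?_⟩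
      rw [span_singleton_le_iff_mem, hk]
      exact smul_mem _ _ (mem_span_singleton_self b)

/-- the potential -/
noncomputable def pot (B : V →ₗ[ℚ] V →ₗ[ℚ] ℚ) (r : V) : List V → ℚ
  | [] => 0
  | a :: l => pot B r l + B (prd B (a :: l) r) r

/-- descending chains -/
def Dsc (B : V →ₗ[ℚ] V →ₗ[ℚ] ℚ) (r : V) : List V → Prop
  | [] => True
  | a :: l => Dsc B r l ∧ B (prd B (a :: l) r) r < B (prd B l r) r

theorem f_refl (a z r : V) :
    B (reflV B a z) r = B z r - 2 * B z a / B a a * B a r := by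
  simp [reflV_apply]

theorem IsPNRootLattice.reg (h : IsPNRootLattice B Φ) {r : V} (hr : ∀ a ∈ Φ, B r a ≠ 0)
    (l : List V) (hl : ∀ x ∈ l, x ∈ Φ) : ∀ a ∈ Φ, B (prd B l r) a ≠ 0 := by
  induction l with
  | nil => simpa [prd_nil] using hr
  | cons b l ih =>
    intro a ha
    have hb := hl b (by simp)
    have := ih (fun x hx => hl x (by simp [hx])) _ (h.refl_mem hb ha)
    rw [prd_cons, Module.End.mul_apply]
    rwa [← h.iso hb, h.invol hb] at this

theorem IsPNRootLattice.improve (h : IsPNRootLattice B Φ) {r z a b : V}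
    (ha : a ∈ Φ) (hb : b ∈ Φ) (hab : B a b ^ 2 < B a a * B b b)
    (h1 : B z r < B (reflV B a z) r) (h2 : B z r < B (reflV B b z) r) :
    B z r < B (reflV B a (reflV B b z)) r ∨ B z r < B (reflV B b (reflV B a z)) r := by
  by_contra! hcon
  obtain ⟨h3, h4⟩ := hcon
  have hA := h.pos ha
  have hB := h.pos hb
  have hs := h.symm a b
  simp only [f_refl, ← hs] at h1 h2 h3 h4
  generalize hza : 2 * B z a / B a a = x at *
  generalize hzb : 2 * B z b / B b b = y at *
  have e3 : 2 * (B z a - y * B a b) / B a a = x - y * (2 * B a b / B a a) := by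
    rw [← hza]; field_simp
  have e4 : 2 * (B z b - x * B a b) / B b b = y - x * (2 * B a b / B b b) := by
    rw [← hzb]; field_simp
  rw [e3] at h3
  rw [e4] at h4
  have hmn : (2 * B a b / B a a) * (2 * B a b / B b b) < 4 := by
    rw [div_mul_div_comm, div_lt_iff₀ (mul_pos hA hB)]
    nlinarith
  generalize (2 * B a b / B a a) = m at *
  generalize (2 * B a b / B b b) = n at *
  generalize B a r = P at *
  generalize B b r = Q at *
  have hX : 0 < -(x * P) := by linarith
  have hY : 0 < -(y * Q) := by linarith
  have k1 : -(x * P) + -(y * Q) ≤ -(m * y * P) := by linarith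
  have k2 : -(x * P) + -(y * Q) ≤ -(n * x * Q) := by linarith
  have k3 := mul_le_mul k1 k2 (by linarith) (by linarith)
  have k4 : -(m * y * P) * -(n * x * Q) = (m * n) * (-(x * P) * -(y * Q)) := by ring
  have k5 := mul_lt_mul_of_pos_right hmn (mul_pos hX hY)
  nlinarith [sq_nonneg (-(x * P) - -(y * Q))]

theorem IsPNRootLattice.step (h : IsPNRootLattice B Φ) {r : V} (hr : ∀ a ∈ Φ, B r a ≠ 0)
    (l : List V) (hl : ∀ x ∈ l, x ∈ Φ) :
    Dsc B r l ∨ Rdc B Φ l ∨ ∃ l', Eqv B Φ l l' ∧ pot B r l < pot B r l' := by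
  induction l with
  | nil => left; trivial
  | cons a l ih =>
    have ha := hl a (by simp)
    have hl' : ∀ x ∈ l, x ∈ Φ := fun x hx => hl x (by simp [hx])
    rcases ih hl' with hd | hd | ⟨l', he, hp⟩
    · cases l with
      | nil =>
        left
        refine ⟨trivial, ?_⟩
        rw [prd_cons, Module.End.mul_apply, prd_nil, Module.End.one_apply, f_refl, h.symm a r]
        have h1 := hr a ha
        have h2 := h.pos ha
        have : 0 < 2 * B r a / B a a * B r a := by
          rw [div_mul_eq_mul_div]
          apply div_pos _ h2
          have := mul_self_pos.2 h1
          linarith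
        linarith
      | cons b t =>
        have hb := hl' b (by simp)
        have ht : ∀ x ∈ t, x ∈ Φ := fun x hx => hl' x (by simp [hx])
        obtain ⟨hd1, hd2⟩ := id hd
        rcases le_or_gt (B a a * B b b) (B a b ^ 2) with hpar | hpar
        · right; left
          obtain ⟨h1, g, hg, h2⟩ := h.par ha hb hpar
          refine ⟨t, g, hg, ht, by simp, ?_, ?_⟩
          · rw [prd_cons, prd_cons, h1]
            ext x
            simp only [Module.End.mul_apply]
            rw [h.invol hb]
          · rw [zsp_cons, zsp_cons, ← sup_assoc, h2, sup_comm]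
        · rcases lt_trichotomy (B (prd B (a :: b :: t) r) r) (B (prd B (b :: t) r) r)
            with hlt | heq | hgt
          · left; exact ⟨hd, hlt⟩
          · exfalso
            rw [prd_cons a, Module.End.mul_apply, f_refl, sub_eq_self] at heq
            have h1 := h.reg hr _ hl' a ha
            have h2 := (h.pos ha).ne'
            have h3 := hr a ha
            rw [h.symm] at h3
            have : 2 * (B (prd B (b :: t) r)) a / (B a) a * (B a) r ≠ 0 := by positivity
            exact this heq
          · right; right
            rw [prd_cons a, Module.End.mul_apply] at hgt
            have hy : reflV B b (prd B (b :: t) r) = prd B t r := by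
              rw [prd_cons, Module.End.mul_apply, h.invol hb]
            have hbt : prd B (b :: t) r = reflV B b (prd B t r) := by
              rw [prd_cons, Module.End.mul_apply]
            rw [← hy] at hd2
            rcases h.improve ha hb hpar hgt hd2 with hi | hi
            · have hE : Eqv B Φ (a :: b :: t) (reflV B a b :: a :: t) := by
                refine ⟨?_, by simp, ?_, ?_⟩
                · simpa using ⟨h.refl_mem ha hb, ha, ht⟩
                · rw [prd_cons, prd_cons, prd_cons, prd_cons, ← mul_assoc, h.swap1 ha, mul_assoc]
                · rw [zsp_cons, zsp_cons, zsp_cons, zsp_cons, ← sup_assoc, ← sup_assoc,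
                    sup_comm (span ℤ {reflV B a b}), h.zsp_swap ha hb]
              refine ⟨_, hE, ?_⟩
              simp only [pot]
              rw [hE.2.2.1]
              rw [hy] at hi
              have : prd B (a :: t) r = reflV B a (prd B t r) := by
                rw [prd_cons, Module.End.mul_apply]
              rw [this]
              linarith
            · have hE : Eqv B Φ (a :: b :: t) (b :: reflV B b a :: t) := by
                refine ⟨?_, by simp, ?_, ?_⟩
                · simpa using ⟨hb, h.refl_mem hb ha, ht⟩
                · rw [prd_cons, prd_cons, prd_cons, prd_cons, ← mul_assoc, h.swap2 hb, mul_assoc]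
                · rw [zsp_cons, zsp_cons, zsp_cons, zsp_cons, ← sup_assoc, ← sup_assoc,
                    h.zsp_swap hb ha, sup_comm (span ℤ {a})]
              refine ⟨_, hE, ?_⟩
              simp only [pot]
              rw [hE.2.2.1]
              have : prd B (reflV B b a :: t) r = reflV B b (reflV B a (prd B (b :: t) r)) := by
                rw [prd_cons, Module.End.mul_apply, hbt, ← h.conj hb, h.invol hb]
              rw [this]
              linarith
    · right; left; exact hd.cons ha
    · right; right
      refine ⟨a :: l', he.cons ha, ?_⟩
      simp only [pot]
      rw [(he.cons ha).2.2.1]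
      linarith

theorem IsPNRootLattice.fin_lists (h : IsPNRootLattice B Φ) (n : ℕ) :
    {l : List V | (∀ x ∈ l, x ∈ Φ) ∧ l.length ≤ n}.Finite := by
  have : Finite Φ := h.finite
  refine ((List.finite_length_le Φ n).image (List.map Subtype.val)).subset ?_
  rintro l ⟨h1, h2⟩
  lift l to List Φ using h1
  exact ⟨l, by simpa using h2, rfl⟩

theorem IsPNRootLattice.step' (h : IsPNRootLattice B Φ) {r : V} (hr : ∀ a ∈ Φ, B r a ≠ 0)
    (l : List V) (hl : ∀ x ∈ l, x ∈ Φ) :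
    Rdc B Φ l ∨ ∃ l', Eqv B Φ l l' ∧ Dsc B r l' := by
  obtain ⟨l', he, hmax⟩ := Set.exists_max_image {l' | Eqv B Φ l l'} (pot B r)
    ((h.fin_lists l.length).subset fun l' he => ⟨he.1, he.2.1.le⟩) ⟨l, hl, rfl, rfl, rfl⟩
  rcases h.step hr l' he.1 with hd | hd | ⟨l₂, he2, hp⟩
  · exact Or.inr ⟨l', he, hd⟩
  · exact Or.inl (hd.of_eqv he)
  · exfalso
    have : Eqv B Φ l l₂ := ⟨he2.1, he2.2.1.trans he.2.1, he2.2.2.1.trans he.2.2.1,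
      he2.2.2.2.trans he.2.2.2⟩
    exact absurd (hmax l₂ this) (not_le.2 hp)

theorem IsPNRootLattice.prd_iso (h : IsPNRootLattice B Φ) (l : List V) (hl : ∀ x ∈ l, x ∈ Φ)
    (x y : V) : B (prd B l x) (prd B l y) = B x y := by
  induction l with
  | nil => simp [prd_nil]
  | cons a l ih =>
    rw [prd_cons, Module.End.mul_apply, Module.End.mul_apply, h.iso (hl a (by simp)),
      ih fun x hx => hl x (by simp [hx])]

theorem IsPNRootLattice.exists_u (h : IsPNRootLattice B Φ) : ∃ u : V, ∀ a ∈ Φ, B u a ≠ 0 := by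
  have : Finite Φ := h.finite
  obtain ⟨u, hu⟩ := Module.Dual.exists_forall_ne_zero_of_forall_exists
    (fun a : Φ => (B a.1 : Module.Dual ℚ V)) (fun a => ⟨a.1, (h.pos a.2).ne'⟩)
  refine ⟨u, fun a ha => ?_⟩
  rw [h.symm]
  exact hu ⟨a, ha⟩

open Filter Topology in
theorem IsPNRootLattice.exists_r (h : IsPNRootLattice B Φ) (l : List V) (v : V)
    (hv : prd B l v = v) : ∃ r : V, (∀ a ∈ Φ, B r a ≠ 0) ∧
      ∀ t : List V, (∀ x ∈ t, x ∈ Φ) → t.length ≤ l.length → prd B t v ≠ v →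
        B (prd B t r) r < B (prd B l r) r := by
  obtain ⟨u, hu⟩ := h.exists_u
  have hlim : ∀ t : List V, Tendsto (fun e : ℚ => B (prd B t (v + e • u)) (v + e • u)) (𝓝[>] 0)
      (𝓝 (B (prd B t v) v)) := by
    intro t
    have : Continuous (fun e : ℚ => B (prd B t (v + e • u)) (v + e • u)) := by
      simp only [map_add, map_smul, LinearMap.add_apply, LinearMap.smul_apply, smul_eq_mul]
      fun_prop
    have := (this.tendsto 0).mono_left (nhdsWithin_le_nhds (s := Set.Ioi 0))
    simpa using this
  have E1 : ∀ᶠ e : ℚ in 𝓝[>] 0, ∀ a ∈ Φ, B (v + e • u) a ≠ 0 := by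
    rw [eventually_all_finite h.finite]
    intro a ha
    by_cases hva : B v a = 0
    · filter_upwards [self_mem_nhdsWithin] with e he
      have he : (0:ℚ) < e := he
      simp [hva, he.ne', hu a ha]
    · have hc : Continuous (fun e : ℚ => B (v + e • u) a) := by
        simp only [map_add, map_smul, LinearMap.add_apply, LinearMap.smul_apply, smul_eq_mul]
        fun_prop
      have := (hc.tendsto 0).mono_left (nhdsWithin_le_nhds (s := Set.Ioi 0))
      exact this.eventually_ne (by simpa using hva)
  have E2 : ∀ᶠ e : ℚ in 𝓝[>] 0, ∀ t ∈ {t : List V | (∀ x ∈ t, x ∈ Φ) ∧ t.length ≤ l.length},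
      prd B t v ≠ v → B (prd B t (v + e • u)) (v + e • u) < B (prd B l (v + e • u)) (v + e • u) := by
    rw [eventually_all_finite (h.fin_lists _)]
    rintro t ⟨ht, -⟩
    by_cases htv : prd B t v = v
    · simp [htv]
    · have hlt : B (prd B t v) v < B (prd B l v) v := by
        rw [hv]
        have := h.posdef _ (sub_ne_zero.2 htv)
        simp only [map_sub, LinearMap.sub_apply] at this
        rw [h.prd_iso t ht, h.symm v (prd B t v)] at this
        linarith
      filter_upwards [(hlim t).eventually_lt (hlim l) hlt] with e he _ using he
  obtain ⟨e, he1, he2⟩ := (E1.and E2).exists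
  exact ⟨v + e • u, he1, fun t ht htl => he2 t ⟨ht, htl⟩⟩

theorem Dsc.le {r : V} {l : List V} (hd : Dsc B r l) {t : List V} (ht : t <:+ l) :
    B (prd B l r) r ≤ B (prd B t r) r := by
  induction l with
  | nil => rw [List.suffix_nil.1 ht]
  | cons a l ih =>
    rcases List.suffix_cons_iff.1 ht with rfl | ht
    · exact le_rfl
    · exact hd.2.le.trans (ih hd.1 ht)

theorem IsPNRootLattice.fix_all (h : IsPNRootLattice B Φ) (v : V) (l : List V)
    (hl : ∀ x ∈ l, x ∈ Φ) (hf : ∀ t, t <:+ l → prd B t v = v) : ∀ x ∈ l, B v x = 0 := by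
  induction l with
  | nil => simp
  | cons a l ih =>
    have h1 := hf l (List.suffix_cons a l)
    have h2 := hf (a :: l) List.suffix_rfl
    have ha := hl a (by simp)
    rw [prd_cons, Module.End.mul_apply, h1, reflV_apply, sub_eq_self, smul_eq_zero] at h2
    have h3 := h2.resolve_right (h.ne_zero a ha)
    have h4 := (h.pos ha).ne'
    have h5 : B v a = 0 := by
      by_contra h5
      have : 2 * B v a / B a a ≠ 0 := by positivity
      exact this h3
    intro x hx
    rcases List.mem_cons.1 hx with rfl | hx
    · exact h5
    · exact ih (fun x hx => hl x (by simp [hx]))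
        (fun t ht => hf t (ht.trans (List.suffix_cons a l))) x hx

theorem IsPNRootLattice.rdc_of_fix (h : IsPNRootLattice B Φ) (v : V) (l : List V)
    (hl : ∀ x ∈ l, x ∈ Φ) (hv : prd B l v = v) (hne : ∃ x ∈ l, B v x ≠ 0) : Rdc B Φ l := by
  obtain ⟨r, hr, hr2⟩ := h.exists_r l v hv
  rcases h.step' hr l hl with hd | ⟨l', he, hd⟩
  · exact hd
  · exfalso
    have hall : ∀ x ∈ l', B v x = 0 := by
      refine h.fix_all v l' he.1 fun t ht => ?_
      by_contra htv
      have h1 := hr2 t (fun x hx => he.1 x (ht.subset hx)) (ht.length_le.trans he.2.1.le) htv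
      have h2 := hd.le ht
      rw [he.2.2.1] at h2
      linarith
    obtain ⟨x, hx, hxv⟩ := hne
    have hx' : x ∈ zsp l' := by
      rw [he.2.2.2]
      exact subset_span hx
    have hle : zsp l' ≤ (LinearMap.ker (B v)).restrictScalars ℤ := span_le.2 fun a ha => hall a ha
    exact hxv (hle hx')

/-- independent lists -/
def Ind : List V → Prop
  | [] => True
  | a :: l => a ∉ qsp l ∧ Ind l

theorem sub_mem_qsp (l : List V) (x : V) : prd B l x - x ∈ qsp l := by
  induction l with
  | nil => simp [prd_nil]
  | cons a l ih =>
    rw [prd_cons, Module.End.mul_apply, reflV_apply, qsp_cons]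
    have := sub_mem (mem_sup_right (S := span ℚ {a}) ih)
      (mem_sup_left (T := qsp l) (smul_mem _ (2 * B (prd B l x) a / B a a)
        (mem_span_singleton_self (R := ℚ) a)))
    convert this using 1
    abel

theorem IsPNRootLattice.ker_ind (h : IsPNRootLattice B Φ) (l : List V) (hl : ∀ x ∈ l, x ∈ Φ)
    (hi : Ind l) (x : V) (hx : prd B l x = x) : ∀ a ∈ l, B x a = 0 := by
  induction l with
  | nil => simp
  | cons a l ih =>
    have ha := hl a (by simp)
    have h4 := (h.pos ha).ne'
    have h1 : prd B l x = reflV B a x := by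
      rw [← h.invol ha (prd B l x), ← Module.End.mul_apply (reflV B a) (prd B l), ← prd_cons, hx]
    have h2 := sub_mem_qsp (B := B) l x
    rw [h1, reflV_apply, sub_sub_cancel_left, neg_mem_iff] at h2
    have h5 : B x a = 0 := by
      by_contra h5
      have : 2 * B x a / B a a ≠ 0 := by positivity
      exact hi.1 ((smul_mem_iff _ this).1 h2)
    have h6 : prd B l x = x := by
      rw [h1, reflV_apply, h5]; simp
    intro y hy
    rcases List.mem_cons.1 hy with rfl | hy
    · exact h5
    · exact ih (fun x hx => hl x (by simp [hx])) hi.2 h6 y hy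

theorem IsPNRootLattice.surj_ind [FiniteDimensional ℚ V] (h : IsPNRootLattice B Φ)
    (l : List V) (hl : ∀ x ∈ l, x ∈ Φ)
    (hi : Ind l) (y : V) (hy : y ∈ qsp l) : ∃ z, prd B l z - z = y := by
  let T : V →ₗ[ℚ] V := prd B l - 1
  have hT : ∀ x, T x = prd B l x - x := fun x => by simp [T]
  let S : qsp l →ₗ[ℚ] qsp l := T.restrict (fun x _ => by rw [hT]; exact sub_mem_qsp l x)
  have hinj : Function.Injective S := by
    rw [← LinearMap.ker_eq_bot, LinearMap.ker_eq_bot']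
    rintro ⟨x, hx⟩ hS
    have h1 : T x = 0 := congrArg Subtype.val hS
    rw [hT, sub_eq_zero] at h1
    have h2 := h.ker_ind l hl hi x h1
    have h3 : qsp l ≤ LinearMap.ker (B x) := span_le.2 fun a ha => h2 a ha
    have h4 : B x x = 0 := h3 hx
    by_contra hne
    have : x ≠ 0 := fun h0 => hne (Subtype.ext h0)
    exact (h.posdef x this).ne' h4
  obtain ⟨z, hz⟩ := LinearMap.injective_iff_surjective.1 hinj ⟨y, hy⟩
  refine ⟨z, ?_⟩
  rw [← hT]
  exact congrArg Subtype.val hz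

theorem IsPNRootLattice.rdc_of_not_ind [FiniteDimensional ℚ V] (h : IsPNRootLattice B Φ)
    (l : List V) (hl : ∀ x ∈ l, x ∈ Φ) (hi : ¬ Ind l) : Rdc B Φ l := by
  induction l with
  | nil => exact absurd trivial hi
  | cons a l ih =>
    have ha := hl a (by simp)
    have hp := (h.pos ha).ne'
    have hl' : ∀ x ∈ l, x ∈ Φ := fun x hx => hl x (by simp [hx])
    by_cases hl2 : Ind l
    · have hmem : a ∈ qsp l := by
        by_contra hc
        exact hi ⟨hc, hl2⟩
      obtain ⟨z, hz⟩ := h.surj_ind l hl' hl2 a hmem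
      have hz' : prd B l z = z + a := by rw [← hz]; abel
      have hn := h.prd_iso l hl' z z
      rw [hz'] at hn
      simp only [map_add, LinearMap.add_apply] at hn
      rw [h.symm a z] at hn
      have hza : B z a = - B a a / 2 := by linarith
      refine h.rdc_of_fix z _ hl ?_ ⟨a, by simp, ?_⟩
      · rw [prd_cons, Module.End.mul_apply, hz', reflV_apply]
        have : 2 * B (z + a) a / B a a = 1 := by
          simp only [map_add, LinearMap.add_apply, hza]
          field_simp
          ring
        rw [this]; simp
      · rw [hza]
        intro h0
        apply hp
        linarith
    · exact (ih hl' hl2).cons ha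

theorem finrank_qsp_le (l : List V) : Module.finrank ℚ (qsp l) ≤ l.length := by
  classical
  have := finrank_span_finset_le_card (R := ℚ) l.toFinset
  have e : (qsp l) = span ℚ (l.toFinset : Set V) := by
    unfold qsp; congr 1; ext x; simp
  rw [e]
  exact this.trans (List.toFinset_card_le l)

theorem finrank_qsp_ind [FiniteDimensional ℚ V] (l : List V) (hi : Ind l) :
    l.length ≤ Module.finrank ℚ (qsp l) := by
  induction l with
  | nil => simp
  | cons a l ih =>
    have h1 := ih hi.2
    have h2 : qsp l < qsp (a :: l) := by
      rw [qsp_cons]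
      refine lt_of_le_of_ne le_sup_right fun he => hi.1 ?_
      rw [he]
      exact mem_sup_left (mem_span_singleton_self a)
    have := Submodule.finrank_lt_finrank_of_lt h2
    simp; omega

theorem IsPNRootLattice.ind_min [FiniteDimensional ℚ V] (h : IsPNRootLattice B Φ)
    (l l' : List V) (hl : ∀ x ∈ l, x ∈ Φ) (hi : Ind l) (he : prd B l = prd B l') :
    l.length ≤ l'.length := by
  have : qsp l ≤ qsp l' := by
    intro y hy
    obtain ⟨z, hz⟩ := h.surj_ind l hl hi y hy
    rw [← hz, he]
    exact sub_mem_qsp l' z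
  exact (finrank_qsp_ind l hi).trans ((Submodule.finrank_mono this).trans (finrank_qsp_le l'))

theorem zsp_append (l l' : List V) : zsp (l ++ l') = zsp l ⊔ zsp l' := by
  unfold zsp
  rw [← span_union]
  congr 1
  ext x
  simp

theorem IsPNRootLattice.descend [FiniteDimensional ℚ V] (h : IsPNRootLattice B Φ)
    (l₀ : List V) (k : ℕ) : ∀ (l : List V), (∀ x ∈ l, x ∈ Φ) → prd B l = prd B l₀ →
      l.length = l₀.length + 2 * k → ∃ l' g : List V, (∀ x ∈ l', x ∈ Φ) ∧ (∀ x ∈ g, x ∈ Φ) ∧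
        prd B l' = prd B l₀ ∧ l'.length = l₀.length ∧ g.length = k ∧ zsp l' ⊔ zsp g = zsp l := by
  induction k with
  | zero =>
    intro l hl he hn
    exact ⟨l, [], hl, by simp, he, by simpa using hn, rfl, by simp [zsp]⟩
  | succ k ih =>
    intro l hl he hn
    have hi : ¬ Ind l := fun hi => by
      have := h.ind_min l l₀ hl hi he
      omega
    obtain ⟨l₁, g, hg, h1, h2, h3, h4⟩ := h.rdc_of_not_ind l hl hi
    obtain ⟨l', gs, a1, a2, a3, a4, a5, a6⟩ := ih l₁ h1 (h3.trans he) (by omega)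
    refine ⟨l', g :: gs, a1, by simpa using ⟨hg, a2⟩, a3, a4, by simp [a5], ?_⟩
    rw [zsp_cons, ← h4, ← a6, sup_comm (span ℤ {g}), sup_assoc]

theorem IsPNRootLattice.double (h : IsPNRootLattice B Φ) (g : List V) (hg : ∀ x ∈ g, x ∈ Φ)
    (l : List V) (hl : ∀ x ∈ l, x ∈ Φ) :
    ∃ l' : List V, (∀ x ∈ l', x ∈ Φ) ∧ prd B l' = prd B l ∧ l'.length = l.length + 2 * g.length ∧
      zsp l' = zsp l ⊔ zsp g := by
  induction g with
  | nil => exact ⟨l, hl, rfl, by simp, by simp [zsp]⟩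
  | cons a g ih =>
    have ha := hg a (by simp)
    obtain ⟨l', h1, h2, h3, h4⟩ := ih (fun x hx => hg x (by simp [hx]))
    refine ⟨a :: a :: l', by simpa using ⟨ha, h1⟩, ?_, by simp; omega, ?_⟩
    · rw [← h2, prd_cons, prd_cons]
      ext x
      exact h.invol ha _
    · rw [zsp_cons, zsp_cons, zsp_cons, ← sup_assoc, sup_idem, h4, sup_left_comm]

theorem range_get_eq (g : List V) : span ℤ (Set.range g.get) = zsp g := by
  unfold zsp
  congr 1
  ext x
  simp [List.mem_iff_get]

end Aux

/-- For any Weyl group element `w` of a p.n. root lattice, `k₅(L, w) = k₄(L, w)`. -/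
theorem stmt5 {V : Type} [AddCommGroup V] [Module ℚ V] [FiniteDimensional ℚ V] [Nontrivial V]
    (B : V →ₗ[ℚ] V →ₗ[ℚ] ℚ) (Φ : Set V) (h : IsPNRootLattice B Φ)
    (w : Module.End ℚ V) (hw : ∃ l : List V, IsPres B Φ w l) :
    k5 B Φ w = k4 B Φ w := by
  have hlen : ∃ l : List V, IsPres B Φ w l ∧ l.length = len B Φ w :=
    Nat.sInf_mem (s := {k | ∃ l : List V, IsPres B Φ w l ∧ l.length = k})
      (hw.elim fun l hl => ⟨_, l, hl, rfl⟩)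
  obtain ⟨l₀, ⟨hl₀, hw₀⟩, hn₀⟩ := hlen
  have hk2 : ∀ L1 : Submodule ℤ V, L1 ≤ span ℤ Φ → ∃ f : Fin (k2 Φ L1) → V,
      (∀ i, f i ∈ Φ) ∧ L1 ⊔ span ℤ (Set.range f) = span ℤ Φ := by
    intro L1 hL1
    refine Nat.sInf_mem (s := {k | ∃ f : Fin k → V, (∀ i, f i ∈ Φ) ∧
      L1 ⊔ span ℤ (Set.range f) = span ℤ Φ}) ?_
    refine ⟨h.finite.toFinset.toList.length, h.finite.toFinset.toList.get, fun i => ?_, ?_⟩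
    · have := List.get_mem h.finite.toFinset.toList i
      exact h.finite.mem_toFinset.1 (Finset.mem_toList.1 this)
    · rw [range_get_eq]
      have : zsp h.finite.toFinset.toList = span ℤ Φ := by
        unfold zsp; congr 1; ext x; simp
      rw [this, sup_eq_right.2 hL1]
  -- an optimal reduced presentation
  obtain ⟨l₁, ⟨hl₁, hw₁⟩, hn₁, hk₁⟩ : ∃ l : List V, IsPres B Φ w l ∧ l.length = len B Φ w ∧
      k2 Φ (span ℤ {α | α ∈ l}) = k4 B Φ w :=
    Nat.sInf_mem (s := {m | ∃ l : List V, IsPres B Φ w l ∧ l.length = len B Φ w ∧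
      k2 Φ (span ℤ {α | α ∈ l}) = m}) ⟨_, l₀, ⟨hl₀, hw₀⟩, hn₀, rfl⟩
  have hmem : ∃ l : List V, IsPres B Φ w l ∧ l.length = len B Φ w + 2 * k4 B Φ w ∧
      span ℤ {α | α ∈ l} = span ℤ Φ := by
    obtain ⟨f, hf, hs⟩ := hk2 (span ℤ {α | α ∈ l₁}) (span_mono hl₁)
    obtain ⟨l', a1, a2, a3, a4⟩ := h.double (List.ofFn f) (by simpa [List.mem_ofFn] using hf) l₁ hl₁
    refine ⟨l', ⟨a1, a2.trans hw₁⟩, ?_, ?_⟩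
    · rw [a3, hn₁, List.length_ofFn, hk₁]
    · have e : zsp (List.ofFn f) = span ℤ (Set.range f) := by
        unfold zsp; congr 1; ext x; simp [List.mem_ofFn]
      rw [e] at a4
      exact a4.trans hs
  apply le_antisymm
  · exact Nat.sInf_le hmem
  · obtain ⟨l, ⟨hl, hwl⟩, hn, hs⟩ : ∃ l : List V, IsPres B Φ w l ∧
        l.length = len B Φ w + 2 * k5 B Φ w ∧ span ℤ {α | α ∈ l} = span ℤ Φ :=
      Nat.sInf_mem (s := {k | ∃ l : List V, IsPres B Φ w l ∧ l.length = len B Φ w + 2 * k ∧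
        span ℤ {α | α ∈ l} = span ℤ Φ}) ⟨_, hmem⟩
    obtain ⟨l', g, a1, a2, a3, a4, a5, a6⟩ := h.descend l₀ (k5 B Φ w) l hl
      (hwl.trans hw₀.symm) (by rw [hn, hn₀])
    have s1 : k4 B Φ w ≤ k2 Φ (span ℤ {α | α ∈ l'}) :=
      Nat.sInf_le ⟨l', ⟨a1, a3.trans hw₀⟩, a4.trans hn₀, rfl⟩
    have s2 : k2 Φ (span ℤ {α | α ∈ l'}) ≤ g.length :=
      Nat.sInf_le ⟨g.get, fun i => a2 _ (List.get_mem g i), by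
        rw [range_get_eq]; exact a6.trans hs⟩
    omega
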